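/- Let g ⊆ so(V) be a Lie subalgebra acting irreducibly on V such that K(g,V) is one-dimensional, and let T ∈ Λ³V satisfy T_X ∈ g for all X ∈ V. Then ⟨X⌟T, Y⌟T⟩ = (3/n)|T|²⟨X,Y⟩ for all X,Y ∈ V, where ⟨X⌟T, Y⌟T⟩ = Σ_{i<j} T(X,eᵢ,eⱼ)T(Y,eᵢ,eⱼ) and |T|² = Σ_{i<j<k} T(eᵢ,eⱼ,eₖ)² for an orthonormal basis {eᵢ} of V. -/

import Mathlib

open scoped RealInnerProductSpace BigOperators

noncomputable section

variable {V : Type} [NormedAddCommGroup V] [InnerProductSpace ℝ V] [FiniteDimensional ℝ V]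

/-- A skew-symmetric endomorphism of a real inner product space. -/
def IsSkew (A : V →ₗ[ℝ] V) : Prop := ∀ x y : V, ⟪A x, y⟫ = - ⟪x, A y⟫

/-- Membership in `K(g,V)`: a `g`-valued algebraic curvature tensor, i.e. an
antisymmetric bilinear map `V × V → g` satisfying the first Bianchi identity. -/
def IsCurv (g : Submodule ℝ (V →ₗ[ℝ] V))
    (R : V →ₗ[ℝ] V →ₗ[ℝ] (V →ₗ[ℝ] V)) : Prop :=
  (∀ X Y : V, R X Y ∈ g) ∧
  (∀ X Y : V, R X Y = - R Y X) ∧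
  (∀ X Y Z : V, R X Y Z + R Y Z X + R Z X Y = 0)

theorem sum_two_aux {n : ℕ} (f : Fin n → Fin n → ℝ) (hs : ∀ i j, f i j = f j i)
    (hd : ∀ i, f i i = 0) :
    ∑ i, ∑ j, f i j = 2 * ∑ i, ∑ j ∈ Finset.Ioi i, f i j := by
  have h1 : ∀ i, ∑ j ∈ Finset.Ioi i, f i j = ∑ j, if i < j then f i j else 0 := by
    intro i
    rw [← Finset.sum_filter]
    congr 1
    ext j; simp
  simp only [h1]
  have h2 : ∀ i j, f i j = (if i < j then f i j else 0) + (if j < i then f j i else 0) := by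
    intro i j
    rcases lt_trichotomy i j with h | h | h
    · simp [h, h.not_gt]
    · subst h; simp [hd]
    · simp [h, h.not_gt, hs i j]
  have h3 : ∑ i, ∑ j, f i j = ∑ i, ∑ j, (if i < j then f i j else 0)
      + ∑ i, ∑ j, (if j < i then f j i else 0) := by
    rw [← Finset.sum_add_distrib]
    refine Finset.sum_congr rfl fun i _ => ?_
    rw [← Finset.sum_add_distrib]
    exact Finset.sum_congr rfl fun j _ => h2 i j
  rw [h3, Finset.sum_comm (f := fun i j => if j < i then f j i else 0)]
  ring

theorem sum_three_aux {n : ℕ} (f : Fin n → Fin n → Fin n → ℝ)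
    (hs : ∀ i j k, f i j k = f j i k) (hs' : ∀ i j k, f i j k = f i k j)
    (hd : ∀ i k, f i i k = 0) :
    ∑ i, ∑ j, ∑ k, f i j k
      = 6 * ∑ i, ∑ j ∈ Finset.Ioi i, ∑ k ∈ Finset.Ioi j, f i j k := by
  set G : Fin n → Fin n → Fin n → ℝ := fun i j k => if i < j ∧ j < k then f i j k else 0 with hG
  have h1 : ∑ i, ∑ j ∈ Finset.Ioi i, ∑ k ∈ Finset.Ioi j, f i j k = ∑ i, ∑ j, ∑ k, G i j k := by
    refine Finset.sum_congr rfl fun i _ => ?_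
    have : Finset.Ioi i = Finset.univ.filter (fun j => i < j) := by ext; simp
    rw [this, Finset.sum_filter]
    refine Finset.sum_congr rfl fun j _ => ?_
    have : Finset.Ioi j = Finset.univ.filter (fun k => j < k) := by ext; simp
    rw [this, Finset.sum_filter]
    by_cases hij : i < j <;> simp [hG, hij]
  have h2 : ∀ i j k, f i j k = G i j k + G i k j + G j i k + G j k i + G k i j + G k j i := by
    intro i j k
    have e1 : f i k j = f i j k := (hs' _ _ _).symm
    have e2 : f j i k = f i j k := (hs _ _ _).symm
    have e3 : f j k i = f i j k := by rw [hs' j k i, e2]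
    have e4 : f k i j = f i j k := by rw [hs k i j, e1]
    have e5 : f k j i = f i j k := by rw [hs' k j i, e4]
    simp only [hG, e1, e2, e3, e4, e5]
    have d1 : i = j → f i j k = 0 := by rintro rfl; exact hd _ _
    have d2 : i = k → f i j k = 0 := by rintro rfl; rw [hs']; exact hd _ _
    have d3 : j = k → f i j k = 0 := by rintro rfl; rw [← e3]; exact hd _ _
    generalize f i j k = a at *
    rcases lt_trichotomy i j with h | h | h <;> rcases lt_trichotomy i k with h' | h' | h' <;>
      rcases lt_trichotomy j k with h'' | h'' | h'' <;>
      first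
      | (exfalso; omega)
      | (simp [d1 h]; done)
      | (simp [d2 h']; done)
      | (simp [d3 h'']; done)
      | (simp [h, h', h'', h.not_gt, h'.not_gt, h''.not_gt]; done)
  rw [h1]
  have h3 : ∑ i, ∑ j, ∑ k, f i j k = ∑ i, ∑ j, ∑ k, G i j k + ∑ i, ∑ j, ∑ k, G i k j
      + ∑ i, ∑ j, ∑ k, G j i k + ∑ i, ∑ j, ∑ k, G j k i + ∑ i, ∑ j, ∑ k, G k i j
      + ∑ i, ∑ j, ∑ k, G k j i := by
    simp only [← Finset.sum_add_distrib]
    exact Finset.sum_congr rfl fun i _ => Finset.sum_congr rfl fun j _ =>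
      Finset.sum_congr rfl fun k _ => h2 i j k
  have c1 : ∀ F : Fin n → Fin n → Fin n → ℝ, ∑ i, ∑ j, ∑ k, F i k j = ∑ i, ∑ j, ∑ k, F i j k :=
    fun F => Finset.sum_congr rfl fun i _ => Finset.sum_comm
  have c2 : ∀ F : Fin n → Fin n → Fin n → ℝ, ∑ i, ∑ j, ∑ k, F j i k = ∑ i, ∑ j, ∑ k, F i j k :=
    fun F => Finset.sum_comm
  have s1 := c1 G
  have s2 := c2 G
  have s3 := c2 (fun i j k => G i k j)
  have s4 := c1 (fun i j k => G j i k)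
  have s5 := c1 (fun i j k => G j k i)
  linarith

/-- The bilinear map `X, Y ↦ [L X, L Y] + 2 L (L X Y)`. -/
def RT (L : V →ₗ[ℝ] V →ₗ[ℝ] V) : V →ₗ[ℝ] V →ₗ[ℝ] (V →ₗ[ℝ] V) :=
  LinearMap.mk₂ ℝ (fun X Y => L X ∘ₗ L Y - L Y ∘ₗ L X + (2 : ℝ) • L (L X Y))
    (by intros; ext; simp; abel)
    (by intros; ext; simp; module)
    (by intros; ext; simp; abel)
    (by intros; ext; simp; module)

/-- The derivation action of `A` on `R`. -/
def actR (A : V →ₗ[ℝ] V) (R : V →ₗ[ℝ] V →ₗ[ℝ] (V →ₗ[ℝ] V)) :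
    V →ₗ[ℝ] V →ₗ[ℝ] (V →ₗ[ℝ] V) :=
  LinearMap.mk₂ ℝ (fun X Y => A ∘ₗ R X Y - R X Y ∘ₗ A - R (A X) Y - R X (A Y))
    (by intros; ext; simp; abel)
    (by intros; ext; simp [smul_sub])
    (by intros; ext; simp; abel)
    (by intros; ext; simp [smul_sub])

/-- The Ricci contraction. -/
def ricR (R : V →ₗ[ℝ] V →ₗ[ℝ] (V →ₗ[ℝ] V)) (X Y : V) : ℝ :=
  LinearMap.trace ℝ V ((R.flip X).flip Y)

theorem ricR_smul (c : ℝ) (R : V →ₗ[ℝ] V →ₗ[ℝ] (V →ₗ[ℝ] V)) (X Y : V) :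
    ricR (c • R) X Y = c * ricR R X Y := by
  have : ((c • R).flip X).flip Y = c • ((R.flip X).flip Y) := by ext; simp
  rw [ricR, this, map_smul]; rfl

theorem ricR_act (A : V →ₗ[ℝ] V) (R : V →ₗ[ℝ] V →ₗ[ℝ] (V →ₗ[ℝ] V)) (X Y : V) :
    ricR (actR A R) X Y = - ricR R X (A Y) - ricR R (A X) Y := by
  have : ((actR A R).flip X).flip Y = A * ((R.flip X).flip Y) - ((R.flip X).flip Y) * A
      - (R.flip X).flip (A Y) - (R.flip (A X)).flip Y := by
    ext Z; simp [actR]; abel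
  rw [ricR, this, map_sub, map_sub, map_sub, LinearMap.trace_mul_comm]
  simp [ricR]

theorem actR_curv (g : Submodule ℝ (V →ₗ[ℝ] V))
    (hglie : ∀ A ∈ g, ∀ B ∈ g, A ∘ₗ B - B ∘ₗ A ∈ g)
    (A : V →ₗ[ℝ] V) (hA : A ∈ g) (R : V →ₗ[ℝ] V →ₗ[ℝ] (V →ₗ[ℝ] V)) (hR : IsCurv g R) :
    IsCurv g (actR A R) := by
  obtain ⟨h1, h2, h3⟩ := hR
  refine ⟨fun X Y => ?_, fun X Y => ?_, fun X Y Z => ?_⟩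
  · simp only [actR, LinearMap.mk₂_apply]
    exact g.sub_mem (g.sub_mem (hglie _ hA _ (h1 _ _)) (h1 _ _)) (h1 _ _)
  · ext Z
    simp only [actR, LinearMap.mk₂_apply]
    rw [h2 X Y, h2 (A X) Y, h2 X (A Y)]
    simp; abel
  · simp only [actR, LinearMap.mk₂_apply, LinearMap.sub_apply, LinearMap.comp_apply]
    have e := congrArg A (h3 X Y Z)
    simp only [map_add, map_zero] at e
    have e1 := h3 (A X) Y Z
    have e2 := h3 X (A Y) Z
    have e3 := h3 X Y (A Z)
    linear_combination (norm := module) e - e1 - e2 - e3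

theorem stmt_8
    (g : Submodule ℝ (V →ₗ[ℝ] V))
    (hgskew : ∀ A ∈ g, IsSkew A)
    (hglie : ∀ A ∈ g, ∀ B ∈ g, A ∘ₗ B - B ∘ₗ A ∈ g)
    (hirr : ∀ W : Submodule ℝ V, (∀ A ∈ g, ∀ x ∈ W, A x ∈ W) → W = ⊥ ∨ W = ⊤)
    -- `K(g,V)` is one-dimensional
    (R0 : V →ₗ[ℝ] V →ₗ[ℝ] (V →ₗ[ℝ] V)) (hR0 : IsCurv g R0) (hR0ne : R0 ≠ 0)
    (hKdim : ∀ R : V →ₗ[ℝ] V →ₗ[ℝ] (V →ₗ[ℝ] V), IsCurv g R → ∃ c : ℝ, R = c • R0)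
    (T : AlternatingMap ℝ V ℝ (Fin 3))
    (TX : V → (V →ₗ[ℝ] V))
    (hTX : ∀ X Y Z : V, ⟪TX X Y, Z⟫ = T ![X, Y, Z])
    (hTg : ∀ X : V, TX X ∈ g) :
    ∀ (n : ℕ) (e : OrthonormalBasis (Fin n) ℝ V) (X Y : V),
      (∑ i : Fin n, ∑ j ∈ Finset.Ioi i, T ![X, e i, e j] * T ![Y, e i, e j]) =
        (3 / (n : ℝ)) *
          (∑ i : Fin n, ∑ j ∈ Finset.Ioi i, ∑ k ∈ Finset.Ioi j,
            (T ![e i, e j, e k]) ^ 2) * ⟪X, Y⟫ := by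
  intro n e X Y
  have sw1 : ∀ X Y Z : V, T ![X, Y, Z] = - T ![Y, X, Z] := by
    intro X Y Z
    have := T.map_swap ![X, Y, Z] (i := 0) (j := 1) (by decide)
    rw [← neg_eq_iff_eq_neg, ← this]
    congr 1
    ext i; fin_cases i <;> rfl
  have sw2 : ∀ X Y Z : V, T ![X, Y, Z] = - T ![X, Z, Y] := by
    intro X Y Z
    have := T.map_swap ![X, Y, Z] (i := 1) (j := 2) (by decide)
    rw [← neg_eq_iff_eq_neg, ← this]
    congr 1
    ext i; fin_cases i <;> rfl
  have hadd : ∀ X Y, TX (X + Y) = TX X + TX Y := by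
    intro X Y
    ext Z
    refine ext_inner_right ℝ fun W => ?_
    rw [LinearMap.add_apply, inner_add_left, hTX, hTX, hTX]
    exact T.map_vecCons_add ![Z, W] X Y
  have hsmul : ∀ (c : ℝ) X, TX (c • X) = c • TX X := by
    intro c X
    ext Z
    refine ext_inner_right ℝ fun W => ?_
    rw [LinearMap.smul_apply, real_inner_smul_left, hTX, hTX]
    exact T.map_vecCons_smul ![Z, W] c X
  let L : V →ₗ[ℝ] V →ₗ[ℝ] V := { toFun := TX, map_add' := hadd, map_smul' := hsmul }
  have hL : ∀ X Y Z, ⟪L X Y, Z⟫ = T ![X, Y, Z] := hTX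
  have hLg : ∀ X, L X ∈ g := hTg
  clear_value L
  have hLs : ∀ X Y, L X Y = - L Y X := by
    intro X Y
    refine ext_inner_right ℝ fun W => ?_
    rw [inner_neg_left, hL, hL, sw1]
  have hLk : ∀ X Y Z, ⟪L X Y, Z⟫ = - ⟪Y, L X Z⟫ := fun X Y Z => hgskew _ (hLg X) Y Z
  have hRT : IsCurv g (RT L) := by
    refine ⟨fun X Y => ?_, fun X Y => ?_, fun X Y Z => ?_⟩
    · exact g.add_mem (hglie _ (hLg X) _ (hLg Y)) (g.smul_mem _ (hLg _))
    · simp only [RT, LinearMap.mk₂_apply]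
      rw [hLs X Y]
      ext Z
      simp; abel
    · simp only [RT, LinearMap.mk₂_apply, LinearMap.sub_apply, LinearMap.comp_apply,
        LinearMap.add_apply, LinearMap.smul_apply]
      rw [hLs (L X Y) Z, hLs (L Y Z) X, hLs (L Z X) Y, hLs Y X, hLs Z Y, hLs X Z]
      simp only [map_neg]
      module
  -- the symmetric operator
  let S : V →ₗ[ℝ] V := - ∑ i, L (e i) ∘ₗ L (e i)
  have hS : ∀ X Y, ⟪S X, Y⟫ = ∑ i, ⟪L X (e i), L Y (e i)⟫ := by
    intro X Y
    simp only [S, LinearMap.neg_apply, LinearMap.sum_apply, LinearMap.comp_apply, inner_neg_left,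
      sum_inner]
    rw [← Finset.sum_neg_distrib]
    refine Finset.sum_congr rfl fun i _ => ?_
    rw [hLk, hLs X, hLs Y]
    simp
  have hS2 : ∀ X Y, ⟪S X, Y⟫ = ∑ i, ∑ j, T ![X, e i, e j] * T ![Y, e i, e j] := by
    intro X Y
    rw [hS]
    refine Finset.sum_congr rfl fun i _ => ?_
    rw [← e.sum_inner_mul_inner]
    refine Finset.sum_congr rfl fun j _ => ?_
    rw [real_inner_comm _ (e j), hL, hL]
  clear_value S
  have hSsym : S.IsSymmetric := by
    intro X Y
    rw [hS, real_inner_comm, hS]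
    exact Finset.sum_congr rfl fun i _ => real_inner_comm _ _
  have hric : ∀ X Y, ricR (RT L) X Y = -3 * ⟪S X, Y⟫ := by
    intro X Y
    rw [ricR, LinearMap.trace_eq_sum_inner _ e, hS, Finset.mul_sum]
    refine Finset.sum_congr rfl fun i _ => ?_
    simp only [RT, LinearMap.flip_apply, LinearMap.mk₂_apply, LinearMap.sub_apply,
      LinearMap.comp_apply, LinearMap.add_apply, LinearMap.smul_apply]
    rw [inner_add_right, inner_sub_right, real_inner_smul_right]
    have z : L (e i) (e i) = 0 := by
      have := hLs (e i) (e i)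
      linear_combination (norm := module) (1 / 2 : ℝ) • this
    have a1 : ⟪e i, L (e i) (L X Y)⟫ = 0 := by
      have := hLk (e i) (e i) (L X Y)
      rw [z, inner_zero_left] at this
      linarith
    have a2 : ⟪e i, L X (L (e i) Y)⟫ = ⟪L X (e i), L Y (e i)⟫ := by
      have := hLk X (e i) (L (e i) Y)
      rw [hLs (e i) Y, inner_neg_right] at this
      rw [hLs (e i) Y]
      linarith
    have a3 : ⟪e i, L (L (e i) X) Y⟫ = - ⟪L X (e i), L Y (e i)⟫ := by
      rw [hLs _ Y, inner_neg_right, ← hLk, hLs (e i) X, inner_neg_right, real_inner_comm]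
    rw [a1, a2, a3]
    ring
  have htr : LinearMap.trace ℝ V S = ∑ i, ∑ j, ∑ k, (T ![e i, e j, e k]) ^ 2 := by
    rw [LinearMap.trace_eq_sum_inner _ e]
    refine Finset.sum_congr rfl fun i _ => ?_
    rw [real_inner_comm, hS2]
    simp only [sq]
  -- commutation
  have hcomm : ∀ A ∈ g, A * S = S * A := by
    intro A hA
    obtain ⟨d, hd⟩ := hKdim _ hRT
    obtain ⟨c, hc⟩ := hKdim _ (actR_curv g hglie A hA R0 hR0)
    have key : ∀ X Y, - ⟪S X, A Y⟫ - ⟪S (A X), Y⟫ = c * ⟪S X, Y⟫ := by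
      intro X Y
      have h1 := ricR_act A R0 X Y
      rw [hc, ricR_smul] at h1
      have h2 : ∀ X Y, d * ricR R0 X Y = -3 * ⟪S X, Y⟫ := by
        intro X Y; rw [← hric, hd, ricR_smul]
      have q1 := h2 X Y
      have q2 := h2 (A X) Y
      have q3 := h2 X (A Y)
      linear_combination (d/3) * h1 - c/3 * q1 - 1/3 * q2 - 1/3 * q3
    have hop : A * S - S * A = c • S := by
      ext X
      refine ext_inner_right ℝ fun Y => ?_
      have := key X Y
      simp only [LinearMap.sub_apply, Module.End.mul_apply, LinearMap.smul_apply, inner_sub_left,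
        real_inner_smul_left]
      rw [hgskew A hA]
      exact this
    have ht : c * LinearMap.trace ℝ V S = 0 := by
      have := congrArg (LinearMap.trace ℝ V) hop
      rw [map_sub, LinearMap.trace_mul_comm, sub_self, map_smul, smul_eq_mul] at this
      exact this.symm
    rcases mul_eq_zero.mp ht with h | h
    · rw [h, zero_smul] at hop
      exact sub_eq_zero.mp hop
    · suffices S = 0 by simp [this]
      rw [htr] at h
      have h0 : ∀ i j k, T ![e i, e j, e k] = 0 := by
        intro i j k
        rw [Finset.sum_eq_zero_iff_of_nonneg (fun _ _ => by positivity)] at h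
        have h := h i (Finset.mem_univ _)
        rw [Finset.sum_eq_zero_iff_of_nonneg (fun _ _ => by positivity)] at h
        have h := h j (Finset.mem_univ _)
        rw [Finset.sum_eq_zero_iff_of_nonneg (fun _ _ => by positivity)] at h
        have h := h k (Finset.mem_univ _)
        exact pow_eq_zero_iff (two_ne_zero) |>.mp h
      refine e.toBasis.ext fun i => ?_
      refine ext_inner_right ℝ fun Y => ?_
      simp [hS2, h0]
  -- Schur
  have hfin : Module.finrank ℝ V = n := by
    rw [Module.finrank_eq_card_basis e.toBasis, Fintype.card_fin]
  rcases Nat.eq_zero_or_pos n with hn | hn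
  · subst hn
    simp
  have hnt : Nontrivial V := Module.nontrivial_of_finrank_pos (R := ℝ) (by omega)
  obtain ⟨l, hl⟩ : ∃ l : ℝ, Module.End.HasEigenvalue S l :=
    ⟨_, hSsym.hasEigenvalue_iSup_of_finiteDimensional⟩
  have htop : Module.End.eigenspace S l = ⊤ := by
    rcases hirr (Module.End.eigenspace S l) (by
      intro A hA x hx
      rw [Module.End.mem_eigenspace_iff] at hx ⊢
      have := congrArg (fun M : V →ₗ[ℝ] V => M x) (hcomm A hA)
      simp only [Module.End.mul_apply] at this
      rw [← this, hx, map_smul]) with h | h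
    · exact absurd h hl
    · exact h
  have hSl : ∀ x, S x = l • x := by
    intro x
    have : x ∈ Module.End.eigenspace S l := htop ▸ Submodule.mem_top
    exact Module.End.mem_eigenspace_iff.mp this
  have htr2 : LinearMap.trace ℝ V S = l * n := by
    have : S = l • (1 : Module.End ℝ V) := by ext x; simp [hSl]
    rw [this, map_smul, LinearMap.trace_one, hfin, smul_eq_mul]
  have zz : ∀ X Y : V, T ![X, X, Y] = 0 := by
    intro X Y; have := sw1 X X Y; linarith
  have zz' : ∀ X Y : V, T ![Y, X, X] = 0 := by
    intro X Y; have := sw2 Y X X; linarith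
  have f3 := sum_three_aux (fun i j k => (T ![e i, e j, e k]) ^ 2)
    (fun i j k => by rw [sw1, neg_sq]) (fun i j k => by rw [sw2, neg_sq])
    (fun i k => by simp [zz])
  have f2 := sum_two_aux (fun i j => T ![X, e i, e j] * T ![Y, e i, e j])
    (fun i j => by rw [sw2 X, sw2 Y, neg_mul_neg]) (fun i => by simp [zz'])
  have hn' : (n : ℝ) ≠ 0 := by positivity
  have q := hS2 X Y
  rw [hSl, real_inner_smul_left, f2] at q
  rw [htr2, f3] at htr
  have hlv : l = 6 / n * (∑ i : Fin n, ∑ j ∈ Finset.Ioi i, ∑ k ∈ Finset.Ioi j,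
            (T ![e i, e j, e k]) ^ 2) := by
    field_simp
    linarith
  rw [hlv] at q
  linear_combination (-1/2) * q
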